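/- arXiv:2408.07235 — 2 statements merged into one kernel-verified Lean document; each statement's English description precedes it below -/
import Mathlib

section
/- Let L ∈ B(H,G) satisfy 0 < ‖L‖ ≤ 1, let g : G → (−∞,+∞] be proper with a continuous affine minorant, and let γ > 0. Then the following pointwise inequalities hold on H: (i) L* ▷ g** ≤ L ⊙_γ g, where (L* ▷ g**)(x) = inf { g**(y) : y ∈ G, L*y = x }; (ii) env_γ(g**) ∘ L ≤ L ⊚_γ g ≤ g** ∘ L; (iii) L ⊚_γ g ≤ L ⊙_γ g. -/
open scoped RealInnerProductSpace
open Filter Set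

noncomputable section

/-- Fenchel (Legendre) conjugate of an extended-real-valued function. -/
def fconj {H : Type*} [NormedAddCommGroup H] [InnerProductSpace ℝ H]
    (f : H → EReal) : H → EReal :=
  fun xs => ⨆ x : H, (⟪x, xs⟫ : EReal) - f x

/-- Moreau envelope of index `γ`. -/
def menv {H : Type*} [NormedAddCommGroup H] (γ : ℝ) (f : H → EReal) : H → EReal :=
  fun x => ⨅ y : H, f y + ((‖x - y‖ ^ 2 / (2 * γ) : ℝ) : EReal)

/-- Quadratic kernel `Q`. -/
def qk {H : Type*} [NormedAddCommGroup H] (x : H) : ℝ := ‖x‖ ^ 2 / 2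

/-- Proximal composition `L ⊙_γ g`. -/
def proxComp {H G : Type*} [NormedAddCommGroup H] [InnerProductSpace ℝ H]
    [NormedAddCommGroup G] [InnerProductSpace ℝ G]
    (L : H →L[ℝ] G) (γ : ℝ) (g : G → EReal) : H → EReal :=
  fun x => fconj (fun z => menv (1 / γ) (fconj g) (L z)) x - (((1 / γ) * qk x : ℝ) : EReal)

/-- Proximal cocomposition `L ⊚_γ g`. -/
def proxCocomp {H G : Type*} [NormedAddCommGroup H] [InnerProductSpace ℝ H]
    [NormedAddCommGroup G] [InnerProductSpace ℝ G]
    (L : H →L[ℝ] G) (γ : ℝ) (g : G → EReal) : H → EReal :=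
  fconj (proxComp L (1 / γ) (fconj g))

/-- `f` is proper: not identically `+∞` and never `−∞`. -/
def ProperE {H : Type*} (f : H → EReal) : Prop :=
  (∃ x, f x ≠ ⊤) ∧ ∀ x, f x ≠ ⊥

/-- `f` admits a continuous affine minorant. -/
def HasAffMinorant {H : Type*} [NormedAddCommGroup H] [InnerProductSpace ℝ H]
    (f : H → EReal) : Prop :=
  ∃ (u : H) (c : ℝ), ∀ x, ((⟪x, u⟫ + c : ℝ) : EReal) ≤ f x

/-- Convexity for extended-real-valued functions. -/
def ConvexE {H : Type*} [NormedAddCommGroup H] [InnerProductSpace ℝ H]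
    (f : H → EReal) : Prop :=
  ∀ x y : H, ∀ a b : ℝ, 0 < a → 0 < b → a + b = 1 →
    f (a • x + b • y) ≤ ((a : ℝ) : EReal) * f x + ((b : ℝ) : EReal) * f y

/-- The class `Γ₀`: proper, lower semicontinuous, convex. -/
def IsGamma0 {H : Type*} [NormedAddCommGroup H] [InnerProductSpace ℝ H]
    (f : H → EReal) : Prop :=
  ProperE f ∧ LowerSemicontinuous f ∧ ConvexE f

/-- `p` is a proximal point of `f` at `x`. -/
def IsProx {H : Type*} [NormedAddCommGroup H] (f : H → EReal) (x p : H) : Prop :=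
  ∀ y : H, f p + ((‖x - p‖ ^ 2 / 2 : ℝ) : EReal) ≤ f y + ((‖x - y‖ ^ 2 / 2 : ℝ) : EReal)

/-- Subdifferential. -/
def SubdiffE {H : Type*} [NormedAddCommGroup H] [InnerProductSpace ℝ H]
    (f : H → EReal) (x : H) : Set H :=
  {xs | ∀ y : H, (⟪y - x, xs⟫ : EReal) + f x ≤ f y}

/-- Recession function. -/
def recE {H : Type*} [NormedAddCommGroup H] (f : H → EReal) : H → EReal :=
  fun x => ⨆ y : {y : H // f y ≠ ⊤}, f (x + (y : H)) - f (y : H)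

end

section FenchelMoreau

variable {H G : Type*} [NormedAddCommGroup H] [InnerProductSpace ℝ H]
  [NormedAddCommGroup G] [InnerProductSpace ℝ G]

lemma EReal.le_of_forall_real_ge {a b : EReal} (h : ∀ r : ℝ, b ≤ r → a ≤ r) : a ≤ b :=
  EReal.le_of_forall_lt_iff_le.1 fun r hr => h r hr.le

lemma fconj_le_coe_iff {f : H → EReal} {v : H} {r : ℝ} :
    fconj f v ≤ r ↔ ∀ (x : H) (s : ℝ), f x ≤ s → ⟪x, v⟫ - s ≤ r := by
  rw [fconj, iSup_le_iff]
  refine forall_congr' fun x => ?_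
  generalize f x = e
  induction e with
  | bot =>
    simp only [EReal.coe_sub_bot, top_le_iff, EReal.coe_ne_top, bot_le, true_imp_iff, false_iff,
      not_forall, not_le]
    exact ⟨⟪x, v⟫ - r - 1, by linarith⟩
  | top => simp
  | coe a =>
    norm_cast
    exact ⟨fun h s hs => by linarith, fun h => h a le_rfl⟩

lemma coe_le_menv_iff {E : Type*} [NormedAddCommGroup E] {γ : ℝ} {f : E → EReal} {x : E} {m : ℝ} :
    (m : EReal) ≤ menv γ f x ↔
      ∀ (y : E) (s : ℝ), f y ≤ s → m ≤ s + ‖x - y‖ ^ 2 / (2 * γ) := by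
  rw [menv, le_iInf_iff]
  refine forall_congr' fun y => ?_
  generalize f y = e
  generalize ‖x - y‖ ^ 2 / (2 * γ) = q
  induction e with
  | bot =>
    simp only [EReal.bot_add, le_bot_iff, EReal.coe_ne_bot, bot_le, true_imp_iff, false_iff,
      not_forall, not_le]
    exact ⟨m - q - 1, by linarith⟩
  | top => simp
  | coe a =>
    norm_cast
    exact ⟨fun h s hs => by linarith, fun h => h a le_rfl⟩

lemma menv_le_coe {E : Type*} [NormedAddCommGroup E] {γ : ℝ} {f : E → EReal} {x y : E} {s : ℝ}
    (h : f y ≤ s) :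
    menv γ f x ≤ ((s + ‖x - y‖ ^ 2 / (2 * γ) : ℝ) : EReal) := by
  rw [EReal.coe_add]
  exact (iInf_le _ y).trans (add_le_add_left h _)

lemma fconj_menv_comp_le_coe_iff {L : H →L[ℝ] G} {δ : ℝ} {h : G → EReal} {x : H} {c : ℝ} :
    fconj (fun z => menv δ h (L z)) x ≤ c ↔
      ∀ (z : H) (v : G) (r : ℝ), h v ≤ r → ⟪z, x⟫ - c ≤ r + ‖L z - v‖ ^ 2 / (2 * δ) := by
  rw [fconj_le_coe_iff]
  constructor
  · intro H z v r hr
    linarith [H z _ (menv_le_coe hr)]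
  · intro H z s hs
    have : ((⟪z, x⟫ - c : ℝ) : EReal) ≤ s := (coe_le_menv_iff.2 (H z)).trans hs
    have := EReal.coe_le_coe_iff.1 this
    linarith

lemma proxComp_le_coe_iff {L : H →L[ℝ] G} {γ : ℝ} {g : G → EReal} {x : H} {t : ℝ} :
    proxComp L γ g x ≤ t ↔ ∀ (z : H) (v : G) (r : ℝ), fconj g v ≤ r →
      ⟪z, x⟫ - (t + (1 / γ) * qk x) ≤ r + ‖L z - v‖ ^ 2 / (2 * (1 / γ)) := by
  rw [proxComp, ← fconj_menv_comp_le_coe_iff, EReal.sub_le_iff_le_add (by simp) (by simp),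
    EReal.coe_add]

/-- Every affine minorant, along an affine subspace, of the Moreau envelope of a conjugate
function extends to an affine minorant on the whole space. -/
lemma exists_affine_minorant_menv_fconj [CompleteSpace G] {f : G → EReal} {δ : ℝ} (hδ : 0 < δ)
    (hf : ∃ (v : G) (r : ℝ), fconj f v ≤ r) (L : H →L[ℝ] G) (w₀ : G) (x : H) (c : ℝ)
    (hc : ∀ (z : H) (v : G) (r : ℝ), fconj f v ≤ r →
      ⟪z, x⟫ - c ≤ r + ‖w₀ + L z - v‖ ^ 2 / (2 * δ)) :
    ∃ y : G, (∀ z, ⟪L z, y⟫ = ⟪z, x⟫) ∧ ∀ (w v : G) (r : ℝ), fconj f v ≤ r →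
      ⟪w - w₀, y⟫ - c ≤ r + ‖w - v‖ ^ 2 / (2 * δ) := by
  let S : Set (G × ℝ) :=
    {p | ∃ (v : G) (r : ℝ), fconj f v ≤ r ∧ r + ‖p.1 - v‖ ^ 2 / (2 * δ) < p.2}
  have hS_open : IsOpen S := by
    have : S = ⋃ (v : G) (r : ℝ) (_ : fconj f v ≤ r),
        {p : G × ℝ | r + ‖p.1 - v‖ ^ 2 / (2 * δ) < p.2} := by
      ext p; simp [S]
    rw [this]
    exact isOpen_iUnion fun v => isOpen_iUnion fun r => isOpen_iUnion fun _ =>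
      isOpen_lt (by fun_prop) (by fun_prop)
  have hS_conv : Convex ℝ S := by
    rintro ⟨w₁, t₁⟩ ⟨v₁, r₁, h₁, hlt₁⟩ ⟨w₂, t₂⟩ ⟨v₂, r₂, h₂, hlt₂⟩ a b ha hb hab
    refine ⟨a • v₁ + b • v₂, a * r₁ + b * r₂, ?_, ?_⟩
    · rw [fconj_le_coe_iff] at h₁ h₂ ⊢
      intro z s hs
      have e₁ := mul_le_mul_of_nonneg_left (h₁ z s hs) ha
      have e₂ := mul_le_mul_of_nonneg_left (h₂ z s hs) hb
      have : s = a * s + b * s := by rw [← add_mul, hab, one_mul]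
      rw [inner_add_right, inner_smul_right, inner_smul_right]
      linarith
    · simp only [Prod.smul_mk, Prod.mk_add_mk, smul_eq_mul] at hlt₁ hlt₂ ⊢
      have hq : ‖a • w₁ + b • w₂ - (a • v₁ + b • v₂)‖ ^ 2
          ≤ a * ‖w₁ - v₁‖ ^ 2 + b * ‖w₂ - v₂‖ ^ 2 := by
        have e : a • w₁ + b • w₂ - (a • v₁ + b • v₂) = a • (w₁ - v₁) + b • (w₂ - v₂) := by
          module
        have hn : ‖a • w₁ + b • w₂ - (a • v₁ + b • v₂)‖ ≤ a * ‖w₁ - v₁‖ + b * ‖w₂ - v₂‖ := by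
          rw [e]
          refine (norm_add_le _ _).trans_eq ?_
          rw [norm_smul, norm_smul, Real.norm_of_nonneg ha, Real.norm_of_nonneg hb]
        have hsq := (convexOn_pow 2).2 (norm_nonneg (w₁ - v₁)) (norm_nonneg (w₂ - v₂)) ha hb hab
        simp only [smul_eq_mul] at hsq
        exact (pow_le_pow_left₀ (norm_nonneg _) hn 2).trans hsq
      have hq' := div_le_div_of_nonneg_right hq (by positivity : 0 ≤ 2 * δ)
      rw [add_div, mul_div_assoc, mul_div_assoc] at hq'
      have hlt : a * (r₁ + ‖w₁ - v₁‖ ^ 2 / (2 * δ)) + b * (r₂ + ‖w₂ - v₂‖ ^ 2 / (2 * δ))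
          < a * t₁ + b * t₂ := by
        rcases ha.eq_or_lt with rfl | ha'
        · obtain rfl : b = 1 := by linarith
          linarith
        · have := mul_lt_mul_of_pos_left hlt₁ ha'
          have := mul_le_mul_of_nonneg_left hlt₂.le hb
          linarith
      linarith
  let M : Set (G × ℝ) := Set.range fun z : H => (w₀ + L z, ⟪z, x⟫ - c)
  have hM_conv : Convex ℝ M := by
    rintro _ ⟨z₁, rfl⟩ _ ⟨z₂, rfl⟩ a b - - hab
    refine ⟨a • z₁ + b • z₂, Prod.ext ?_ ?_⟩
    · obtain rfl : a = 1 - b := by linarith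
      simp only [map_add, map_smul, Prod.smul_mk, Prod.mk_add_mk]
      module
    · obtain rfl : a = 1 - b := by linarith
      simp only [inner_add_left, real_inner_smul_left, Prod.smul_mk, Prod.mk_add_mk, smul_eq_mul]
      ring
  have hSM : Disjoint S M := by
    rw [Set.disjoint_left]
    rintro _ ⟨v, r, hv, hlt⟩ ⟨z, rfl⟩
    exact (hc z v r hv).not_gt hlt
  obtain ⟨Φ, u, hΦS, hΦM⟩ := geometric_hahn_banach_open hS_conv hS_open hM_conv hSM
  let β : ℝ := Φ (0, 1)
  let a : G →L[ℝ] ℝ := Φ.comp (ContinuousLinearMap.inl ℝ G ℝ)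
  have hΦ (w : G) (t : ℝ) : Φ (w, t) = a w + t * β := by
    have : ((w, t) : G × ℝ) = (w, 0) + t • (0, 1) := by simp
    rw [this, map_add, map_smul]
    rfl
  obtain ⟨v₀, r₀, hv₀⟩ := hf
  have hβ : β < 0 := by
    set q := r₀ + ‖w₀ - v₀‖ ^ 2 / (2 * δ) with hq
    have hpt := hΦM _ ⟨0, rfl⟩
    have hcz := hc 0 v₀ r₀ hv₀
    simp only [map_zero, add_zero, inner_zero_left, hΦ] at hpt hcz
    have h1 := hΦS (w₀, q + 1) ⟨v₀, r₀, hv₀, by simp [hq]⟩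
    rw [hΦ] at h1
    by_contra! hβ
    have := mul_le_mul_of_nonneg_right (show 0 - c ≤ q + 1 by linarith) hβ
    linarith
  have ha_range (z : H) : a (L z) + ⟪z, x⟫ * β = 0 := by
    set d := a (L z) + ⟪z, x⟫ * β with hd
    have key (k : ℝ) : u ≤ a w₀ - c * β + k * d := by
      have h := hΦM _ ⟨k • z, rfl⟩
      simp only [hΦ, map_add, map_smul, real_inner_smul_left, smul_eq_mul] at h
      rw [hd]
      linarith
    by_contra hne
    have h := key (-(a w₀ - c * β - u + 1) / d)
    rw [div_mul_cancel₀ _ hne] at h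
    linarith
  let y : G := (-β)⁻¹ • (InnerProductSpace.toDual ℝ G).symm a
  have hy (w : G) : ⟪w, y⟫ = (-β)⁻¹ * a w := by
    rw [inner_smul_right, real_inner_comm, InnerProductSpace.toDual_symm_apply]
  refine ⟨y, fun z => ?_, fun w v r hv => ?_⟩
  · rw [hy, inv_mul_eq_iff_eq_mul₀ (by linarith)]
    linarith [ha_range z]
  · rw [hy]
    refine le_of_forall_pos_lt_add fun ε hε => ?_
    have h1 := hΦS (w, r + ‖w - v‖ ^ 2 / (2 * δ) + ε) ⟨v, r, hv, by simpa using hε⟩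
    have h2 := hΦM _ ⟨0, rfl⟩
    simp only [map_zero, add_zero, inner_zero_left, hΦ] at h1 h2
    rw [sub_lt_iff_lt_add, inv_mul_lt_iff₀ (neg_pos.2 hβ), map_sub]
    linarith

/-- Finite upper bounds of the proximal composition at `x` are witnessed by a point of the fibre
of `L*` over `x`. -/
lemma exists_adjoint_eq_of_proxComp_le [CompleteSpace H] [CompleteSpace G] {L : H →L[ℝ] G}
    {γ : ℝ} (hγ : 0 < γ) {g : G → EReal} (hg : ∃ (v : G) (r : ℝ), fconj g v ≤ r) {x : H} {t : ℝ}
    (ht : proxComp L γ g x ≤ t) :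
    ∃ y : G, ContinuousLinearMap.adjoint L y = x ∧
      fconj (fconj g) y ≤ ((t + (‖x‖ ^ 2 - ‖y‖ ^ 2) / (2 * γ) : ℝ) : EReal) := by
  rw [proxComp_le_coe_iff] at ht
  obtain ⟨y, hy, hmin⟩ := exists_affine_minorant_menv_fconj (one_div_pos.2 hγ) hg L 0 x _
    (by simpa using ht)
  refine ⟨y, ext_inner_left ℝ fun z => ?_, fconj_le_coe_iff.2 fun v r hv => ?_⟩
  · rw [ContinuousLinearMap.adjoint_inner_right, hy]
  · have h := hmin (v + γ⁻¹ • y) v r hv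
    rw [sub_zero, inner_add_left, real_inner_smul_left, real_inner_self_eq_norm_sq,
      add_sub_cancel_left, norm_smul, mul_pow, Real.norm_of_nonneg (by positivity), qk] at h
    have e₁ : (γ⁻¹) ^ 2 * ‖y‖ ^ 2 / (2 * (1 / γ)) = ‖y‖ ^ 2 / (2 * γ) := by field_simp
    have e₂ : γ⁻¹ * ‖y‖ ^ 2 = 2 * (‖y‖ ^ 2 / (2 * γ)) := by field_simp
    have e₃ : γ⁻¹ * (‖x‖ ^ 2 / 2) = ‖x‖ ^ 2 / (2 * γ) := by field_simp
    rw [e₁, e₂, e₃] at h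
    rw [sub_div]
    linarith

lemma proxCocomp_le_coe {L : H →L[ℝ] G} {γ : ℝ} {g : G → EReal} {x : H} {y : G} {s t : ℝ}
    (hs : fconj (fconj g) y ≤ s)
    (ht : ∀ u : H, ∃ z : H,
      ⟪u, x⟫ - ⟪z, u⟫ + ‖L z - y‖ ^ 2 / (2 * γ) + s + γ * (‖u‖ ^ 2 / 2) ≤ t) :
    proxCocomp L γ g x ≤ t := by
  refine fconj_le_coe_iff.2 fun u r hr => ?_
  obtain ⟨z, hz⟩ := ht u
  have h := proxComp_le_coe_iff.1 hr z y s hs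
  rw [one_div_one_div, qk] at h
  linarith

lemma menv_fconj_fconj_comp_le_proxCocomp [CompleteSpace H] [CompleteSpace G] (L : H →L[ℝ] G)
    {γ : ℝ} (hγ : 0 < γ) {g : G → EReal} (hg : ∃ (v : G) (r : ℝ), fconj (fconj g) v ≤ r) (x : H) :
    menv γ (fconj (fconj g)) (L x) ≤ proxCocomp L γ g x := by
  refine EReal.ge_of_forall_gt_iff_ge.1 fun m hm => ?_
  have hm' := coe_le_menv_iff.1 hm.le
  obtain ⟨y, -, hy⟩ := exists_affine_minorant_menv_fconj hγ hg (0 : H →L[ℝ] G) (L x) 0 (-m)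
    (by simpa using hm')
  set u := ContinuousLinearMap.adjoint L y with hu
  have hP : proxComp L (1 / γ) (fconj g) u ≤ ((⟪u, x⟫ - m : ℝ) : EReal) := by
    refine proxComp_le_coe_iff.2 fun z v r hv => ?_
    have h := hy (L z) v r hv
    rw [← map_sub, ← ContinuousLinearMap.adjoint_inner_right, ← hu, inner_sub_left] at h
    rw [one_div_one_div, qk, real_inner_comm x u]
    have : 0 ≤ γ * (‖u‖ ^ 2 / 2) := by positivity
    linarith
  calc (m : EReal) = (⟪u, x⟫ : EReal) - ((⟪u, x⟫ - m : ℝ) : EReal) := by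
        rw [← EReal.coe_sub, sub_sub_cancel]
    _ ≤ (⟪u, x⟫ : EReal) - proxComp L (1 / γ) (fconj g) u := EReal.sub_le_sub le_rfl hP
    _ ≤ proxCocomp L γ g x :=
      le_iSup (fun u : H => (⟪u, x⟫ : EReal) - proxComp L (1 / γ) (fconj g) u) u

lemma fconj_fconj_le (g : G → EReal) (x : G) : fconj (fconj g) x ≤ g x := by
  refine EReal.le_of_forall_real_ge fun r hr => fconj_le_coe_iff.2 fun v s hv => ?_
  have := fconj_le_coe_iff.1 hv x r hr
  rw [real_inner_comm]
  linarith

end FenchelMoreau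

/-- Pointwise comparisons: `L* ▷ g** ≤ L ⊙_γ g`,
`env_γ(g**) ∘ L ≤ L ⊚_γ g ≤ g** ∘ L`, and `L ⊚_γ g ≤ L ⊙_γ g`. -/
theorem proxComp_proxCocomp_comparisons
    {H G : Type*} [NormedAddCommGroup H] [InnerProductSpace ℝ H] [CompleteSpace H]
    [NormedAddCommGroup G] [InnerProductSpace ℝ G] [CompleteSpace G]
    (L : H →L[ℝ] G) (hL0 : 0 < ‖L‖) (hL1 : ‖L‖ ≤ 1)
    (g : G → EReal) (hg : ProperE g) (hm : HasAffMinorant g)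
    (γ : ℝ) (hγ : 0 < γ) :
    (∀ x : H, (⨅ y : {y : G // ContinuousLinearMap.adjoint L y = x},
        fconj (fconj g) (y : G)) ≤ proxComp L γ g x) ∧
    (∀ x : H, menv γ (fconj (fconj g)) (L x) ≤ proxCocomp L γ g x) ∧
    (∀ x : H, proxCocomp L γ g x ≤ fconj (fconj g) (L x)) ∧
    (∀ x : H, proxCocomp L γ g x ≤ proxComp L γ g x) := by
  have hdom : ∃ (v : G) (r : ℝ), fconj g v ≤ r := by
    obtain ⟨u, c, h⟩ := hm
    refine ⟨u, -c, fconj_le_coe_iff.2 fun x s hs => ?_⟩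
    have := EReal.coe_le_coe_iff.1 ((h x).trans hs)
    linarith
  have hdom₂ : ∃ (v : G) (r : ℝ), fconj (fconj g) v ≤ r := by
    obtain ⟨x, hx⟩ := hg.1
    exact ⟨x, (g x).toReal, (fconj_fconj_le g x).trans (EReal.le_coe_toReal hx)⟩
  have hLn (z : H) : ‖L z‖ ^ 2 ≤ ‖z‖ ^ 2 :=
    pow_le_pow_left₀ (norm_nonneg _) (by simpa using L.le_of_opNorm_le hL1 z) 2
  refine ⟨fun x => ?_, menv_fconj_fconj_comp_le_proxCocomp L hγ hdom₂, fun x => ?_, fun x => ?_⟩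
  · refine EReal.le_of_forall_real_ge fun t ht => ?_
    obtain ⟨y, rfl, hy⟩ := exists_adjoint_eq_of_proxComp_le hγ hdom ht
    refine (iInf_le _ ⟨y, rfl⟩).trans (hy.trans (EReal.coe_le_coe_iff.2 ?_))
    have hn : ‖ContinuousLinearMap.adjoint L y‖ ^ 2 ≤ ‖y‖ ^ 2 :=
      pow_le_pow_left₀ (norm_nonneg _) (by
        simpa using (ContinuousLinearMap.adjoint L).le_of_opNorm_le
          ((LinearIsometryEquiv.norm_map _ L).trans_le hL1) y) 2
    have := div_nonpos_of_nonpos_of_nonneg (sub_nonpos.2 hn) (by positivity : 0 ≤ 2 * γ)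
    linarith
  · refine EReal.le_of_forall_real_ge fun t ht => proxCocomp_le_coe ht fun u => ⟨x + γ • u, ?_⟩
    have hq : ‖L (x + γ • u) - L x‖ ^ 2 / (2 * γ) ≤ γ * (‖u‖ ^ 2 / 2) := by
      rw [map_add, add_sub_cancel_left, map_smul, norm_smul, mul_pow,
        Real.norm_of_nonneg hγ.le, div_le_iff₀ (by positivity)]
      nlinarith [mul_le_mul_of_nonneg_left (hLn u) (sq_nonneg γ)]
    rw [inner_add_left, real_inner_smul_left, real_inner_self_eq_norm_sq, real_inner_comm]
    linarith
  · refine EReal.le_of_forall_real_ge fun t ht => ?_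
    obtain ⟨y, hyx, hy⟩ := exists_adjoint_eq_of_proxComp_le hγ hdom ht
    refine proxCocomp_le_coe hy fun u => ⟨x + γ • u, ?_⟩
    have hq : ‖L (x + γ • u) - y‖ ^ 2 ≤ γ ^ 2 * ‖u‖ ^ 2 - ‖x‖ ^ 2 + ‖y‖ ^ 2 := by
      have h := hLn (x + γ • u)
      rw [norm_sub_sq_real, ← ContinuousLinearMap.adjoint_inner_right, hyx]
      rw [norm_add_sq_real, norm_smul, mul_pow, Real.norm_of_nonneg hγ.le,
        real_inner_smul_right] at h
      rw [inner_add_left, real_inner_smul_left, real_inner_self_eq_norm_sq, real_inner_comm]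
      linarith
    have hq' := div_le_div_of_nonneg_right hq (by positivity : 0 ≤ 2 * γ)
    have e : (γ ^ 2 * ‖u‖ ^ 2 - ‖x‖ ^ 2 + ‖y‖ ^ 2) / (2 * γ)
        = γ * (‖u‖ ^ 2 / 2) - (‖x‖ ^ 2 - ‖y‖ ^ 2) / (2 * γ) := by
      field_simp
      ring
    rw [inner_add_left, real_inner_smul_left, real_inner_self_eq_norm_sq, real_inner_comm x u]
    linarith
end

section
/- Let L ∈ B(H,G) satisfy 0 < ‖L‖ ≤ 1, let g : G → (−∞,+∞] be proper with a continuous affine minorant, let γ > 0, let x ∈ H, and set Φ = Q_G − Q_H ∘ L*. (i) If y* ∈ ∂g(Lx), then 0 ≤ g(Lx) − (L ⊚_γ g)(x) ≤ γΦ(y*). (ii) If 0 ∈ (Id_G − L∘L*)(∂g(Lx)), i.e. there exists y* ∈ ∂g(Lx) with L(L*y*) = y*, then (L ⊚_γ g)(x) = g(Lx). -/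
open scoped RealInnerProductSpace
open Filter Set

theorem EReal.coe_sub_le_comm {a : ℝ} {u v : EReal} (h : (a : EReal) - u ≤ v) :
    (a : EReal) - v ≤ u := by
  induction u with
  | top => exact le_top
  | bot =>
    rw [EReal.coe_sub_bot, top_le_iff] at h
    simp [h]
  | coe u =>
    induction v with
    | top => simp
    | bot =>
      rw [le_bot_iff] at h
      exact absurd h (EReal.coe_ne_bot (a - u))
    | coe v =>
      norm_cast at h ⊢
      linarith

theorem coe_inner_sub_le_fconj {E : Type*} [NormedAddCommGroup E] [InnerProductSpace ℝ E]
    (f : E → EReal) (x xs : E) : (⟪x, xs⟫ : EReal) - f x ≤ fconj f xs :=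
  le_iSup (fun y : E => (⟪y, xs⟫ : EReal) - f y) x

theorem fconj_fconj_le_s18 {E : Type*} [NormedAddCommGroup E] [InnerProductSpace ℝ E]
    (f : E → EReal) (x : E) : fconj (fconj f) x ≤ f x := by
  refine iSup_le fun xs => EReal.coe_sub_le_comm ?_
  rw [real_inner_comm]
  exact coe_inner_sub_le_fconj f x xs

theorem menv_le {E : Type*} [NormedAddCommGroup E] (γ : ℝ) (f : E → EReal) (x y : E) :
    menv γ f x ≤ f y + ((‖x - y‖ ^ 2 / (2 * γ) : ℝ) : EReal) :=
  iInf_le (fun y : E => f y + ((‖x - y‖ ^ 2 / (2 * γ) : ℝ) : EReal)) y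

/-- An affine minorant with slope `u` passes to the Moreau envelope, losing `γ‖u‖²/2`. -/
theorem le_menv_of_affine_le {E : Type*} [NormedAddCommGroup E] [InnerProductSpace ℝ E]
    {γ : ℝ} (hγ : 0 < γ) {f : E → EReal} {u : E} {c : ℝ}
    (h : ∀ y, ((⟪y, u⟫ + c : ℝ) : EReal) ≤ f y) (x : E) :
    ((⟪x, u⟫ + c - γ * qk u : ℝ) : EReal) ≤ menv γ f x := by
  refine le_iInf fun y => le_trans ?_ (add_le_add_left (h y) _)
  norm_cast
  have hsq : ‖(x - y) - γ • u‖ ^ 2 = ‖x - y‖ ^ 2 - 2 * γ * ⟪x - y, u⟫ + γ ^ 2 * ‖u‖ ^ 2 := by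
    rw [norm_sub_sq_real, inner_smul_right, norm_smul, Real.norm_eq_abs, mul_pow, sq_abs]
    ring
  have hnn : 0 ≤ ‖(x - y) - γ • u‖ ^ 2 / (2 * γ) := by positivity
  have heq : ‖(x - y) - γ • u‖ ^ 2 / (2 * γ)
      = ‖x - y‖ ^ 2 / (2 * γ) - ⟪x - y, u⟫ + γ * qk u := by
    rw [hsq, qk]
    field_simp
  rw [inner_sub_left] at heq
  linarith

/-- An affine minorant of `f` is an affine minorant of its biconjugate. -/
theorem affine_le_fconj_fconj {E : Type*} [NormedAddCommGroup E] [InnerProductSpace ℝ E]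
    {f : E → EReal} {u : E} {c : ℝ} (h : ∀ y, ((⟪y, u⟫ + c : ℝ) : EReal) ≤ f y) (x : E) :
    ((⟪x, u⟫ + c : ℝ) : EReal) ≤ fconj (fconj f) x := by
  have hconj : fconj f u ≤ ((-c : ℝ) : EReal) := by
    refine iSup_le fun y => EReal.coe_sub_le_comm ?_
    refine le_trans (le_of_eq ?_) (h y)
    norm_cast
    ring
  refine le_trans ?_ (coe_inner_sub_le_fconj (fconj f) u x)
  refine le_trans (le_of_eq ?_) (EReal.sub_le_sub le_rfl hconj)
  rw [real_inner_comm]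
  norm_cast
  ring

theorem proxCocomp_le {H G : Type*} [NormedAddCommGroup H] [InnerProductSpace ℝ H]
    [NormedAddCommGroup G] [InnerProductSpace ℝ G]
    {L : H →L[ℝ] G} (hL : ‖L‖ ≤ 1) {g : G → EReal} {γ : ℝ} (hγ : 0 < γ) {x : H} {r : ℝ}
    (hr : g (L x) = r) : proxCocomp L γ g x ≤ r := by
  refine iSup_le fun xs => EReal.coe_sub_le_comm ?_
  rw [proxComp, one_div_one_div]
  have henv : menv γ (fconj (fconj g)) (L (x + γ • xs)) ≤ ((r + γ * qk xs : ℝ) : EReal) := by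
    refine (menv_le γ _ _ (L x)).trans ?_
    refine (add_le_add_left ((fconj_fconj_le_s18 g (L x)).trans hr.le) _).trans ?_
    norm_cast
    have hLxs : ‖L xs‖ ≤ ‖xs‖ := by
      simpa using L.le_of_opNorm_le hL xs
    have hsq : ‖L xs‖ ^ 2 ≤ ‖xs‖ ^ 2 := by gcongr
    rw [← map_sub, add_sub_cancel_left, map_smul, norm_smul, Real.norm_eq_abs, mul_pow, sq_abs,
      qk]
    have : γ ^ 2 * ‖L xs‖ ^ 2 / (2 * γ) = γ * (‖L xs‖ ^ 2 / 2) := by field_simp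
    rw [this]
    gcongr
  have hconj := coe_inner_sub_le_fconj
    (fun z => menv γ (fconj (fconj g)) (L z)) (x + γ • xs) xs
  refine le_trans (le_of_eq ?_)
    (EReal.sub_le_sub ((EReal.sub_le_sub le_rfl henv).trans hconj) le_rfl)
  norm_cast
  rw [inner_add_left, real_inner_smul_left, real_inner_self_eq_norm_sq, real_inner_comm, qk]
  ring

theorem le_proxCocomp {H G : Type*} [NormedAddCommGroup H] [InnerProductSpace ℝ H]
    [CompleteSpace H] [NormedAddCommGroup G] [InnerProductSpace ℝ G] [CompleteSpace G]
    {L : H →L[ℝ] G} {g : G → EReal} {γ : ℝ} (hγ : 0 < γ) {x : H} {r : ℝ}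
    (hr : g (L x) = r) {ys : G} (hys : ys ∈ SubdiffE g (L x)) :
    ((r - γ * (qk ys - qk (ContinuousLinearMap.adjoint L ys)) : ℝ) : EReal)
      ≤ proxCocomp L γ g x := by
  have haff : ∀ y, ((⟪y, ys⟫ + (r - ⟪L x, ys⟫) : ℝ) : EReal) ≤ g y := fun y => by
    refine le_trans (le_of_eq ?_) (hys y)
    rw [hr, inner_sub_left]
    norm_cast
    ring
  have hconj : fconj (fun z => menv γ (fconj (fconj g)) (L z)) (ContinuousLinearMap.adjoint L ys)
      ≤ ((⟪L x, ys⟫ - r + γ * qk ys : ℝ) : EReal) := by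
    refine iSup_le fun z => EReal.coe_sub_le_comm ?_
    refine le_trans (le_of_eq ?_) (le_menv_of_affine_le hγ (affine_le_fconj_fconj haff) (L z))
    rw [ContinuousLinearMap.adjoint_inner_right]
    norm_cast
    ring
  refine le_trans ?_ (coe_inner_sub_le_fconj _ (ContinuousLinearMap.adjoint L ys) x)
  rw [proxComp, one_div_one_div]
  refine le_trans (le_of_eq ?_)
    (EReal.sub_le_sub le_rfl (EReal.sub_le_sub hconj le_rfl))
  rw [ContinuousLinearMap.adjoint_inner_left, real_inner_comm]
  norm_cast
  ring

theorem ProperE.exists_coe_eq_of_mem_subdiffE {E : Type*} [NormedAddCommGroup E]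
    [InnerProductSpace ℝ E] {f : E → EReal} (hf : ProperE f) {x xs : E}
    (h : xs ∈ SubdiffE f x) : ∃ r : ℝ, f x = r := by
  obtain ⟨⟨y, hy⟩, hbot⟩ := hf
  have htop : f x ≠ ⊤ := fun hx => hy <| by
    have := h y
    rwa [hx, EReal.coe_add_top, top_le_iff] at this
  exact ⟨(f x).toReal, (EReal.coe_toReal htop (hbot x)).symm⟩

/-- (i) If `y* ∈ ∂g(Lx)`, then `0 ≤ g(Lx) − (L ⊚_γ g)(x) ≤ γΦ(y*)` with
`Φ = Q_G − Q_H ∘ L*`; (ii) if some `y* ∈ ∂g(Lx)` satisfies `L(L*y*) = y*`, then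
`(L ⊚_γ g)(x) = g(Lx)`. -/
theorem proxCocomp_gap_estimate
    {H G : Type*} [NormedAddCommGroup H] [InnerProductSpace ℝ H] [CompleteSpace H]
    [NormedAddCommGroup G] [InnerProductSpace ℝ G] [CompleteSpace G]
    (L : H →L[ℝ] G) (hL0 : 0 < ‖L‖) (hL1 : ‖L‖ ≤ 1)
    (g : G → EReal) (hg : ProperE g) (hm : HasAffMinorant g)
    (γ : ℝ) (hγ : 0 < γ) (x : H) :
    (∀ ys : G, ys ∈ SubdiffE g (L x) →
        proxCocomp L γ g x ≤ g (L x) ∧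
        g (L x) - proxCocomp L γ g x ≤
          ((γ * (qk ys - qk (ContinuousLinearMap.adjoint L ys)) : ℝ) : EReal)) ∧
    ((∃ ys ∈ SubdiffE g (L x), L (ContinuousLinearMap.adjoint L ys) = ys) →
        proxCocomp L γ g x = g (L x)) := by
  refine ⟨fun ys hys => ?_, fun ⟨ys, hys, hL⟩ => ?_⟩
  · obtain ⟨r, hr⟩ := hg.exists_coe_eq_of_mem_subdiffE hys
    rw [hr]
    refine ⟨proxCocomp_le hL1 hγ hr, EReal.coe_sub_le_comm ?_⟩
    exact_mod_cast le_proxCocomp hγ hr hys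
  · obtain ⟨r, hr⟩ := hg.exists_coe_eq_of_mem_subdiffE hys
    have hq : qk (ContinuousLinearMap.adjoint L ys) = qk ys := by
      rw [qk, qk, ← real_inner_self_eq_norm_sq, ContinuousLinearMap.adjoint_inner_left, hL,
        real_inner_self_eq_norm_sq]
    rw [hr]
    refine le_antisymm (proxCocomp_le hL1 hγ hr) ?_
    simpa [hq] using le_proxCocomp hγ hr hys
end
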